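/- Let φ be a modal μ-calculus formula in normal form such that for every fixpoint subformula μp.ψ or νp.ψ of φ, the variable p occurs only positively in ψ, and let κ : P → Set S be a valuation. Then for every state s : S, s ∈ ⟦φ⟧κ if and only if Player 0 wins the model-checking parity game G(φ) from the vertex (φ, s). -/

import Mathlib

/-- Formulas of the modal μ-calculus over a type `P` of propositional variables:
`⊥ | ⊤ | p | ¬p | φ∧φ | φ∨φ | □φ | ◇φ | μp.φ | νp.φ`. -/
inductive MuForm (P : Type*) where
  | bot : MuForm P
  | top : MuForm P
  | var (p : P) : MuForm P
  | nvar (p : P) : MuForm P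
  | and (φ ψ : MuForm P) : MuForm P
  | or (φ ψ : MuForm P) : MuForm P
  | box (φ : MuForm P) : MuForm P
  | dia (φ : MuForm P) : MuForm P
  | mu (p : P) (φ : MuForm P) : MuForm P
  | nu (p : P) (φ : MuForm P) : MuForm P
  deriving DecidableEq

variable {P S : Type*}

/-- The set of free variables of a μ-calculus formula (`μp`/`νp` bind `p`). -/
def MuForm.freeVars : MuForm P → Set P
  | .bot => ∅
  | .top => ∅
  | .var p => {p}
  | .nvar p => {p}
  | .and φ ψ => φ.freeVars ∪ ψ.freeVars
  | .or φ ψ => φ.freeVars ∪ ψ.freeVars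
  | .box φ => φ.freeVars
  | .dia φ => φ.freeVars
  | .mu p φ => φ.freeVars \ {p}
  | .nu p φ => φ.freeVars \ {p}

/-- `p` occurs only positively in a μ-calculus formula. -/
def MuForm.PositiveIn (p : P) : MuForm P → Prop
  | .bot => True
  | .top => True
  | .var _ => True
  | .nvar q => q ≠ p
  | .and φ ψ => φ.PositiveIn p ∧ ψ.PositiveIn p
  | .or φ ψ => φ.PositiveIn p ∧ ψ.PositiveIn p
  | .box φ => φ.PositiveIn p
  | .dia φ => φ.PositiveIn p
  | .mu q φ => q = p ∨ φ.PositiveIn p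
  | .nu q φ => q = p ∨ φ.PositiveIn p

/-- Semantics `⟦φ⟧κ ⊆ S` of a μ-calculus formula in the Kripke structure with
state type `S`, transition relation `R`, and valuation `κ : P → Set S`. -/
def MuForm.sem [DecidableEq P] (R : S → S → Prop) : MuForm P → (P → Set S) → Set S
  | .bot, _ => ∅
  | .top, _ => Set.univ
  | .var p, κ => κ p
  | .nvar p, κ => (κ p)ᶜ
  | .and φ ψ, κ => φ.sem R κ ∩ ψ.sem R κ
  | .or φ ψ, κ => φ.sem R κ ∪ ψ.sem R κ
  | .box φ, κ => {s | ∀ s', R s s' → s' ∈ φ.sem R κ}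
  | .dia φ, κ => {s | ∃ s', R s s' ∧ s' ∈ φ.sem R κ}
  | .mu p φ, κ => ⋂₀ {X : Set S | φ.sem R (Function.update κ p X) ⊆ X}
  | .nu p φ, κ => ⋃₀ {X : Set S | X ⊆ φ.sem R (Function.update κ p X)}
variable [DecidableEq P]

/-- The finite set of subformulas of a μ-calculus formula. -/
def MuForm.subformulas : MuForm P → Finset (MuForm P)
  | .bot => {.bot}
  | .top => {.top}
  | .var p => {.var p}
  | .nvar p => {.nvar p}
  | .and φ ψ => insert (.and φ ψ) (φ.subformulas ∪ ψ.subformulas)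
  | .or φ ψ => insert (.or φ ψ) (φ.subformulas ∪ ψ.subformulas)
  | .box φ => insert (.box φ) φ.subformulas
  | .dia φ => insert (.dia φ) φ.subformulas
  | .mu p φ => insert (.mu p φ) φ.subformulas
  | .nu p φ => insert (.nu p φ) φ.subformulas

/-- Size of a formula (used as a termination measure). -/
def MuForm.fsize : MuForm P → ℕ
  | .bot => 1
  | .top => 1
  | .var _ => 1
  | .nvar _ => 1
  | .and φ ψ => φ.fsize + ψ.fsize + 1
  | .or φ ψ => φ.fsize + ψ.fsize + 1
  | .box φ => φ.fsize + 1
  | .dia φ => φ.fsize + 1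
  | .mu _ φ => φ.fsize + 1
  | .nu _ φ => φ.fsize + 1

theorem MuForm.fsize_le_of_mem_subformulas :
    ∀ {φ ψ : MuForm P}, ψ ∈ φ.subformulas → ψ.fsize ≤ φ.fsize := by
  intro φ
  induction φ with
  | bot => intro ψ h; simp [MuForm.subformulas] at h; subst h; exact le_refl _
  | top => intro ψ h; simp [MuForm.subformulas] at h; subst h; exact le_refl _
  | var p => intro ψ h; simp [MuForm.subformulas] at h; subst h; exact le_refl _
  | nvar p => intro ψ h; simp [MuForm.subformulas] at h; subst h; exact le_refl _
  | and φ₁ φ₂ ih₁ ih₂ =>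
      intro ψ h; simp [MuForm.subformulas] at h
      rcases h with h | h | h
      · subst h; exact le_refl _
      · exact le_trans (ih₁ h) (by simp [MuForm.fsize]; omega)
      · exact le_trans (ih₂ h) (by simp [MuForm.fsize]; omega)
  | or φ₁ φ₂ ih₁ ih₂ =>
      intro ψ h; simp [MuForm.subformulas] at h
      rcases h with h | h | h
      · subst h; exact le_refl _
      · exact le_trans (ih₁ h) (by simp [MuForm.fsize]; omega)
      · exact le_trans (ih₂ h) (by simp [MuForm.fsize]; omega)
  | box φ ih =>
      intro ψ h; simp [MuForm.subformulas] at h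
      rcases h with h | h
      · subst h; exact le_refl _
      · exact le_trans (ih h) (by simp [MuForm.fsize])
  | dia φ ih =>
      intro ψ h; simp [MuForm.subformulas] at h
      rcases h with h | h
      · subst h; exact le_refl _
      · exact le_trans (ih h) (by simp [MuForm.fsize])
  | mu p φ ih =>
      intro ψ h; simp [MuForm.subformulas] at h
      rcases h with h | h
      · subst h; exact le_refl _
      · exact le_trans (ih h) (by simp [MuForm.fsize])
  | nu p φ ih =>
      intro ψ h; simp [MuForm.subformulas] at h
      rcases h with h | h
      · subst h; exact le_refl _
      · exact le_trans (ih h) (by simp [MuForm.fsize])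

open Classical in
/-- The alternation depth `α(φ)` of a μ-calculus formula.  For `μp.ψ` it is the
maximum of `{1, α(ψ)}` together with all values `α(νp'.ψ') + 1` for ν-subformulas
`νp'.ψ'` of `ψ` in which `p` occurs free, and dually for `νp.ψ`. -/
noncomputable def MuForm.alt : MuForm P → ℕ
  | .bot => 0
  | .top => 0
  | .var _ => 0
  | .nvar _ => 0
  | .and φ ψ => max φ.alt ψ.alt
  | .or φ ψ => max φ.alt ψ.alt
  | .box φ => φ.alt
  | .dia φ => φ.alt
  | .mu p φ => max (max 1 φ.alt)
      (φ.subformulas.attach.sup fun ψ =>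
        if (∃ p' ψ', ψ.1 = MuForm.nu p' ψ') ∧ p ∈ ψ.1.freeVars then ψ.1.alt + 1 else 0)
  | .nu p φ => max (max 1 φ.alt)
      (φ.subformulas.attach.sup fun ψ =>
        if (∃ p' ψ', ψ.1 = MuForm.mu p' ψ') ∧ p ∈ ψ.1.freeVars then ψ.1.alt + 1 else 0)
termination_by φ => φ.fsize
decreasing_by
  all_goals simp [MuForm.fsize]
  all_goals try omega
  all_goals
    have := MuForm.fsize_le_of_mem_subformulas ψ.2
    omega

/-- A parity game: vertices `V`, each owned by Player `0` or Player `1`,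
an edge relation `E`, and a priority function `prio` with finite range. -/
structure ParityGame (V : Type*) where
  owner : V → Fin 2
  E : V → V → Prop
  prio : V → ℕ
  finRange : (Set.range prio).Finite

namespace ParityGame

variable {V : Type*} (G : ParityGame V)

/-- A dead end: a vertex without `E`-successor. -/
def DeadEnd (v : V) : Prop := ∀ w, ¬ G.E v w

/-- `π : ℕ → V` is an infinite play (all consecutive steps are edges). -/
def InfPlay (π : ℕ → V) : Prop := ∀ i, G.E (π i) (π (i + 1))

/-- The set of priorities occurring infinitely often along an infinite play. -/
def InfOften (π : ℕ → V) : Set ℕ := {c | ∀ N, ∃ n, N ≤ n ∧ G.prio (π n) = c}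

/-- An infinite play is won by Player `0` iff the maximum priority occurring
infinitely often is even (max-parity condition). -/
def WinInf (π : ℕ → V) : Prop := Even (sSup (G.InfOften π))

/-- `l` is a finite play from `v`: a nonempty list starting at `v`, with
consecutive `E`-edges, whose last vertex is a dead end. -/
def FinPlay (v : V) (l : List V) : Prop :=
  l.head? = some v ∧ l.Chain' G.E ∧ ∀ x ∈ l.getLast?, G.DeadEnd x

/-- A finite play is won by Player `0` iff its last vertex belongs to Player `1`. -/
def WinFin (l : List V) : Prop := ∀ x ∈ l.getLast?, G.owner x = 1

/-- A strategy (for Player `0`) is valid if it assigns to every finite nonempty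
`E`-path ending in a Player-`0` vertex that is not a dead end an `E`-successor
of that vertex. -/
def ValidStrat (σ : List V → V) : Prop :=
  ∀ (l : List V) (x : V), l.Chain' G.E → l.getLast? = some x →
    G.owner x = 0 → ¬ G.DeadEnd x → G.E x (σ l)

/-- An infinite play conforms to a strategy `σ` if every step taken from a
Player-`0` vertex follows `σ` applied to the path traversed so far. -/
def ConformsInf (σ : List V → V) (π : ℕ → V) : Prop :=
  ∀ i, G.owner (π i) = 0 → π (i + 1) = σ (List.ofFn fun j : Fin (i + 1) => π j)

/-- A finite play conforms to a strategy `σ` if every step taken from a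
Player-`0` vertex follows `σ` applied to the path traversed so far. -/
def ConformsFin (σ : List V → V) (l : List V) : Prop :=
  ∀ (i : ℕ) (h : i + 1 < l.length),
    G.owner (l.get ⟨i, Nat.lt_of_succ_lt h⟩) = 0 →
    l.get ⟨i + 1, h⟩ = σ (l.take (i + 1))

/-- `σ` is a winning strategy for Player `0` from `v`: it is a valid strategy
and every (infinite or finite) play from `v` conforming to it is won by
Player `0`. -/
def WinningFrom (σ : List V → V) (v : V) : Prop :=
  G.ValidStrat σ ∧
    (∀ π : ℕ → V, π 0 = v → G.InfPlay π → G.ConformsInf σ π → G.WinInf π) ∧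
    (∀ l : List V, G.FinPlay v l → G.ConformsFin σ l → G.WinFin l)

/-- Player `0` wins the game from `v` if some strategy is winning for
Player `0` from `v`. -/
def Wins0 (v : V) : Prop := ∃ σ : List V → V, G.WinningFrom σ v

/-- A strategy is memoryless if its value depends only on the last vertex of
the path. -/
def Memoryless (σ : List V → V) : Prop :=
  ∀ (l l' : List V) (x : V), l.getLast? = some x → l'.getLast? = some x → σ l = σ l'

end ParityGame

theorem MuForm.self_mem_subformulas (φ : MuForm P) : φ ∈ φ.subformulas := by
  cases φ <;> simp [MuForm.subformulas]

/-- `p` is bound in `φ`: some fixpoint subformula of `φ` binds `p`. -/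
def MuForm.BoundIn (p : P) (φ : MuForm P) : Prop :=
  ∃ ψ, MuForm.mu p ψ ∈ φ.subformulas ∨ MuForm.nu p ψ ∈ φ.subformulas

/-- `φ` is in normal form: every variable is bound by at most one fixpoint
operator occurring in `φ` (the fixpoint subformula binding a given variable is
unique), and no variable occurs both free and bound in `φ`. -/
def MuForm.NormalForm (φ : MuForm P) : Prop :=
  (∀ (p : P) (χ₁ χ₂ : MuForm P), χ₁ ∈ φ.subformulas → χ₂ ∈ φ.subformulas →
      (∃ ψ, χ₁ = MuForm.mu p ψ ∨ χ₁ = MuForm.nu p ψ) →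
      (∃ ψ, χ₂ = MuForm.mu p ψ ∨ χ₂ = MuForm.nu p ψ) → χ₁ = χ₂) ∧
    ∀ p ∈ φ.freeVars, ¬ MuForm.BoundIn p φ

/-- The vertices `(ψ, s)` of the model-checking game for `φ` that belong to
Player `0`: `ψ` is `⊥`, a disjunction, a `◇`-formula, a `μ`- or `ν`-formula, a
variable bound in `φ`, a variable `p` free in `φ` with `s ∉ κ p`, or a literal
`¬p` with `s ∈ κ p`. -/
def mcPlayer0 (φ : MuForm P) (κ : P → Set S) : MuForm P × S → Prop :=
  fun v => match v.1 with
  | .bot => True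
  | .top => False
  | .var p => MuForm.BoundIn p φ ∨ (p ∈ φ.freeVars ∧ v.2 ∉ κ p)
  | .nvar p => v.2 ∈ κ p
  | .and _ _ => False
  | .or _ _ => True
  | .box _ => False
  | .dia _ => True
  | .mu _ _ => True
  | .nu _ _ => True

/-- The edges of the model-checking game for `φ`: from `(ψ₁∧ψ₂, s)` and
`(ψ₁∨ψ₂, s)` to `(ψ₁, s)` and `(ψ₂, s)`; from `(□ψ, s)` and `(◇ψ, s)` to
`(ψ, s')` for every `s'` with `R s s'`; from `(μp.ψ, s)` and `(νp.ψ, s)` to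
`(ψ, s)`; from `(p, s)` to `(φ_p, s)` where `φ_p` is the fixpoint subformula of
`φ` binding `p`; no edges from `(⊥, s)`, `(⊤, s)`, `(¬p, s)`, or `(p, s)` with
`p` free in `φ`. -/
def mcEdge (R : S → S → Prop) (φ : MuForm P) :
    MuForm P × S → MuForm P × S → Prop :=
  fun v w => match v.1 with
  | .bot => False
  | .top => False
  | .var p => w.2 = v.2 ∧ w.1 ∈ φ.subformulas ∧
      ∃ ψ, w.1 = MuForm.mu p ψ ∨ w.1 = MuForm.nu p ψ
  | .nvar _ => False
  | .and ψ₁ ψ₂ => w.2 = v.2 ∧ (w.1 = ψ₁ ∨ w.1 = ψ₂)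
  | .or ψ₁ ψ₂ => w.2 = v.2 ∧ (w.1 = ψ₁ ∨ w.1 = ψ₂)
  | .box ψ => w.1 = ψ ∧ R v.2 w.2
  | .dia ψ => w.1 = ψ ∧ R v.2 w.2
  | .mu _ ψ => w.2 = v.2 ∧ w.1 = ψ
  | .nu _ ψ => w.2 = v.2 ∧ w.1 = ψ

/-- The priority of a vertex `(ψ, s)` of the model-checking game:
`2⌈α(ψ)/2⌉ − 1` if `ψ` is a `μ`-formula with `α(ψ) > 0`, `2⌊α(ψ)/2⌋` if `ψ` is
a `ν`-formula with `α(ψ) > 0`, and `0` otherwise. -/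
noncomputable def mcPrio : MuForm P → ℕ
  | .mu p ψ => if 0 < (MuForm.mu p ψ).alt then 2 * (((MuForm.mu p ψ).alt + 1) / 2) - 1 else 0
  | .nu p ψ => if 0 < (MuForm.nu p ψ).alt then 2 * ((MuForm.nu p ψ).alt / 2) else 0
  | _ => 0

open Classical in
/-- The model-checking parity game `G(φ)` for a μ-calculus formula `φ` (in
normal form), a Kripke structure with transition relation `R`, and a valuation
`κ`: its vertices are the pairs `(ψ, s)` with `ψ` a subformula of `φ` and `s`
a state. -/
noncomputable def mcGame (R : S → S → Prop) (φ : MuForm P) (κ : P → Set S) :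
    ParityGame ({ψ : MuForm P // ψ ∈ φ.subformulas} × S) where
  owner := fun v => if mcPlayer0 φ κ (v.1.1, v.2) then 0 else 1
  E := fun v w => mcEdge R φ (v.1.1, v.2) (w.1.1, w.2)
  prio := fun v => mcPrio v.1.1
  finRange := by
    have h : (Set.range fun ψ : {ψ : MuForm P // ψ ∈ φ.subformulas} =>
        mcPrio ψ.1).Finite := Set.finite_range _
    exact h.subset (by rintro _ ⟨v, rfl⟩; exact ⟨v.1, rfl⟩)

namespace ParityGame

section Arenas

universe u

variable {V : Type u} (G : ParityGame V) (b : Fin 2)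

/-- The infinite play `π` is won by player `b`. -/
def WonBy (π : ℕ → V) : Prop := b = 0 ↔ G.WinInf π

variable {G b}

theorem WonBy.of_shift {π : ℕ → V} (N : ℕ) (h : G.WonBy b fun i => π (i + N)) :
    G.WonBy b π := by
  have key : G.InfOften (fun i => π (i + N)) = G.InfOften π := by
    ext c
    constructor
    · intro hc K
      obtain ⟨n, hn, hp⟩ := hc K
      exact ⟨n + N, by omega, hp⟩
    · intro hc K
      obtain ⟨n, hn, hp⟩ := hc (K + N)
      refine ⟨n - N, by omega, ?_⟩
      have : n - N + N = n := by omega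
      simpa [this] using hp
  unfold WonBy WinInf at h ⊢
  rwa [key] at h

variable (G b)

/-- A strategy with memory for player `b`, presented as a graph labelled by vertices in `D`.
At vertices in `Z` nothing is required of the player. -/
structure Arena (D Z : Set V) where
  /-- The memory states. -/
  State : Type u
  /-- The vertex at which a memory state is used. -/
  lab : State → V
  /-- The moves that the strategy permits. -/
  next : State → State → Prop
  lab_mem : ∀ m, lab m ∈ D
  edge : ∀ m m', next m m' → G.E (lab m) (lab m')
  own : ∀ m, lab m ∉ Z → G.owner (lab m) = b → ∃ m', next m m'
  opp : ∀ m, lab m ∉ Z → G.owner (lab m) ≠ b → ∀ w, G.E (lab m) w →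
    ∃ m', next m m' ∧ lab m' = w
  won : ∀ π : ℕ → State, (∀ i, next (π i) (π (i + 1))) → G.WonBy b fun i => lab (π i)

/-- From `v`, player `b` can stay in `D` and either win or reach `Z`. -/
def Secures (D Z : Set V) (v : V) : Prop :=
  ∃ (A : G.Arena b D Z) (m : A.State), A.lab m = v

variable {G b}

theorem Secures.mono {D D' Z Z' : Set V} {v : V} (hD : D ⊆ D') (hZ : Z ⊆ Z')
    (h : G.Secures b D Z v) : G.Secures b D' Z' v := by
  obtain ⟨A, m, hm⟩ := h
  exact ⟨⟨A.State, A.lab, A.next, fun m => hD (A.lab_mem m), A.edge,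
    fun m h => A.own m fun h' => h (hZ h'), fun m h => A.opp m fun h' => h (hZ h'), A.won⟩,
    m, hm⟩

/-- A single arena serves all vertices secured by player `b`. -/
theorem exists_universal_arena (D Z : Set V) :
    ∃ A : G.Arena b D Z, ∀ v, G.Secures b D Z v → ∃ m, A.lab m = v := by
  choose A root hroot using fun v : {v // G.Secures b D Z v} => v.2
  refine ⟨{
    State := Σ v, (A v).State
    lab := fun x => (A x.1).lab x.2
    next := fun x y => ∃ v m m', x = ⟨v, m⟩ ∧ y = ⟨v, m'⟩ ∧ (A v).next m m'
    lab_mem := fun x => (A x.1).lab_mem x.2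
    edge := ?_
    own := ?_
    opp := ?_
    won := ?_ }, fun v hv => ⟨⟨⟨v, hv⟩, root ⟨v, hv⟩⟩, hroot ⟨v, hv⟩⟩⟩
  · rintro _ _ ⟨v, m, m', rfl, rfl, h⟩
    exact (A v).edge m m' h
  · rintro ⟨v, m⟩ hZ ho
    obtain ⟨m', h⟩ := (A v).own m hZ ho
    exact ⟨⟨v, m'⟩, v, m, m', rfl, rfl, h⟩
  · rintro ⟨v, m⟩ hZ ho w hw
    obtain ⟨m', h, hl⟩ := (A v).opp m hZ ho w hw
    exact ⟨⟨v, m'⟩, ⟨v, m, m', rfl, rfl, h⟩, hl⟩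
  · intro π hπ
    have hmem : ∀ i, ∃ m, π i = ⟨(π 0).1, m⟩ := by
      intro i
      induction i with
      | zero => exact ⟨_, rfl⟩
      | succ i ih =>
        obtain ⟨m, hm⟩ := ih
        obtain ⟨v, k, k', h, h', -⟩ := hπ i
        obtain rfl : (π 0).1 = v := congrArg Sigma.fst (hm.symm.trans h)
        exact ⟨k', h'⟩
    choose ρ hρ using hmem
    have hnext : ∀ i, (A (π 0).1).next (ρ i) (ρ (i + 1)) := by
      intro i
      obtain ⟨v, k, k', h, h', hk⟩ := hπ i
      obtain rfl : (π 0).1 = v := congrArg Sigma.fst ((hρ i).symm.trans h)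
      obtain rfl : ρ i = k := eq_of_heq (Sigma.mk.inj ((hρ i).symm.trans h)).2
      obtain rfl : ρ (i + 1) = k' := eq_of_heq (Sigma.mk.inj ((hρ (i + 1)).symm.trans h')).2
      exact hk
    have hlab : (fun i => (A (π i).1).lab (π i).2) = fun i => (A (π 0).1).lab (ρ i) :=
      funext fun i => congrArg (fun x : Σ v, (A v).State => (A x.1).lab x.2) (hρ i)
    show G.WonBy b fun i => (A (π i).1).lab (π i).2
    rw [hlab]
    exact (A _).won ρ hnext

/-- Secured vertices are closed under a single move of the game. -/
theorem Secures.of_step {D Z : Set V} {v : V} (hD : v ∈ D) (C : Set V)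
    (hC : ∀ w ∈ C, G.E v w ∧ G.Secures b D Z w)
    (hown : v ∉ Z → G.owner v = b → C.Nonempty)
    (hopp : v ∉ Z → G.owner v ≠ b → ∀ w, G.E v w → w ∈ C) : G.Secures b D Z v := by
  obtain ⟨A, hA⟩ := exists_universal_arena (G := G) (b := b) D Z
  refine ⟨{
    State := Option A.State
    lab := fun x => x.elim v A.lab
    next := fun x y => ∃ m', y = some m' ∧ x.elim (A.lab m' ∈ C) fun m => A.next m m'
    lab_mem := by rintro (_ | m); exacts [hD, A.lab_mem m]
    edge := ?_
    own := ?_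
    opp := ?_
    won := ?_ }, none, rfl⟩
  · rintro (_ | m) _ ⟨m', rfl, h⟩
    exacts [(hC _ h).1, A.edge m m' h]
  · rintro (_ | m) hZ ho
    · obtain ⟨w, hw⟩ := hown hZ ho
      obtain ⟨m', rfl⟩ := hA w (hC w hw).2
      exact ⟨some m', m', rfl, hw⟩
    · obtain ⟨m', h⟩ := A.own m hZ ho
      exact ⟨some m', m', rfl, h⟩
  · rintro (_ | m) hZ ho w hw
    · have hwC := hopp hZ ho w hw
      obtain ⟨m', rfl⟩ := hA w (hC w hwC).2
      exact ⟨some m', ⟨m', rfl, hwC⟩, rfl⟩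
    · obtain ⟨m', h, hl⟩ := A.opp m hZ ho w hw
      exact ⟨some m', ⟨m', rfl, h⟩, hl⟩
  · intro π hπ
    choose ρ hρ hnext using hπ
    apply WonBy.of_shift 1
    simp only [hρ, Option.elim_some]
    refine A.won ρ fun i => ?_
    have := hnext (i + 1)
    rwa [hρ i] at this

theorem Secures.of_mem {D Z : Set V} {v : V} (hD : v ∈ D) (hZ : v ∈ Z) : G.Secures b D Z v :=
  .of_step hD ∅ (by simp) (fun h => absurd hZ h) (fun h => absurd hZ h)

theorem Secures.of_own {D Z : Set V} {v w : V} (hD : v ∈ D) (ho : G.owner v = b)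
    (hE : G.E v w) (h : G.Secures b D Z w) : G.Secures b D Z v :=
  .of_step hD {w} (by rintro _ rfl; exact ⟨hE, h⟩) (fun _ _ => ⟨w, rfl⟩)
    (fun _ h' => absurd ho h')

theorem Secures.of_forall {D Z : Set V} {v : V} (hD : v ∈ D)
    (ho : G.owner v = b → ∃ w, G.E v w)
    (h : ∀ w, G.E v w → G.Secures b D Z w) : G.Secures b D Z v :=
  .of_step hD {w | G.E v w} (fun w hw => ⟨hw, h w hw⟩) (fun _ => ho) (fun _ _ _ h' => h')

theorem Secures.bind {D Z Z' : Set V} {v : V} (h : G.Secures b D Z v)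
    (hZ : ∀ z ∈ D, z ∈ Z → G.Secures b D Z' z) : G.Secures b D Z' v := by
  obtain ⟨A, m₀, rfl⟩ := h
  obtain ⟨B, hB⟩ := exists_universal_arena (G := G) (b := b) D Z'
  refine ⟨{
    State := A.State ⊕ B.State
    lab := Sum.elim A.lab B.lab
    next := fun x y => match x, y with
      | .inl m, .inl m' => A.lab m ∉ Z ∧ A.next m m'
      | .inl m, .inr k' => A.lab m ∈ Z ∧ ∃ k, B.lab k = A.lab m ∧ B.next k k'
      | .inr _, .inl _ => False
      | .inr k, .inr k' => B.next k k'
    lab_mem := by rintro (m | m); exacts [A.lab_mem m, B.lab_mem m]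
    edge := ?_
    own := ?_
    opp := ?_
    won := ?_ }, .inl m₀, rfl⟩
  · rintro (m | m) (m' | m') h
    · exact A.edge _ _ h.2
    · obtain ⟨-, k, hk, h⟩ := h
      have := B.edge _ _ h
      rw [hk] at this
      exact this
    · exact h.elim
    · exact B.edge _ _ h
  · rintro (m | m) hz ho
    · by_cases hm : A.lab m ∈ Z
      · obtain ⟨k, hk⟩ := hB _ (hZ _ (A.lab_mem m) hm)
        obtain ⟨k', h⟩ := B.own k (hk ▸ hz) (hk ▸ ho)
        exact ⟨.inr k', hm, k, hk, h⟩
      · obtain ⟨m', h⟩ := A.own m hm ho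
        exact ⟨.inl m', hm, h⟩
    · obtain ⟨m', h⟩ := B.own m hz ho
      exact ⟨.inr m', h⟩
  · rintro (m | m) hz ho w hw
    · by_cases hm : A.lab m ∈ Z
      · obtain ⟨k, hk⟩ := hB _ (hZ _ (A.lab_mem m) hm)
        obtain ⟨k', h, hl⟩ := B.opp k (hk ▸ hz) (hk ▸ ho) w (hk ▸ hw)
        exact ⟨.inr k', ⟨hm, k, hk, h⟩, hl⟩
      · obtain ⟨m', h, hl⟩ := A.opp m hm ho w hw
        exact ⟨.inl m', ⟨hm, h⟩, hl⟩
    · obtain ⟨m', h, hl⟩ := B.opp m hz ho w hw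
      exact ⟨.inr m', h, hl⟩
  · intro π hπ
    by_cases hinr : ∃ N k, π N = .inr k
    · obtain ⟨N, hN⟩ := hinr
      have hmem : ∀ i, ∃ k, π (i + N) = .inr k := by
        intro i
        induction i with
        | zero => simpa using hN
        | succ i ih =>
          obtain ⟨k, hk⟩ := ih
          have := hπ (i + N)
          rw [hk, show i + N + 1 = i + 1 + N by omega] at this
          rcases hy : π (i + 1 + N) with m' | k'
          · rw [hy] at this
            exact this.elim
          · exact ⟨k', rfl⟩
      choose ρ hρ using hmem
      apply WonBy.of_shift N
      simp only [hρ, Sum.elim_inr]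
      refine B.won ρ fun i => ?_
      have := hπ (i + N)
      rw [hρ i, show i + N + 1 = i + 1 + N by omega, hρ (i + 1)] at this
      exact this
    · have hmem : ∀ i, ∃ m, π i = .inl m := by
        intro i
        rcases hi : π i with m | k
        · exact ⟨m, rfl⟩
        · exact absurd ⟨i, k, hi⟩ hinr
      choose ρ hρ using hmem
      simp only [hρ, Sum.elim_inl]
      refine A.won ρ fun i => ?_
      have := hπ i
      rw [hρ i, hρ (i + 1)] at this
      exact this.2

/-- If every play that visits `L` infinitely often is won, then `L` may be removed from the
target as soon as the successors of the vertices in `L` are secured. -/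
theorem Secures.loop {D Z L : Set V} {v : V} (h : G.Secures b D (Z ∪ L) v)
    (hL : ∀ l ∈ L, (∃ w, G.E l w) ∧ ∀ w, G.E l w → G.Secures b D (Z ∪ L) w)
    (hwon : ∀ π : ℕ → V, G.InfPlay π → (∀ i, π i ∈ D) → (∀ N, ∃ n, N ≤ n ∧ π n ∈ L) →
      G.WonBy b π) : G.Secures b D Z v := by
  obtain ⟨A, hA⟩ := exists_universal_arena (G := G) (b := b) D (Z ∪ L)
  obtain ⟨m₀, rfl⟩ := hA v h
  have hedge : ∀ m m', (A.lab m ∉ L ∧ A.next m m' ∨ A.lab m ∈ L ∧ G.E (A.lab m) (A.lab m')) →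
      G.E (A.lab m) (A.lab m') := by
    rintro m m' (⟨-, h⟩ | ⟨-, h⟩)
    exacts [A.edge _ _ h, h]
  refine ⟨{
    State := A.State
    lab := A.lab
    next := fun m m' => A.lab m ∉ L ∧ A.next m m' ∨ A.lab m ∈ L ∧ G.E (A.lab m) (A.lab m')
    lab_mem := A.lab_mem
    edge := hedge
    own := ?_
    opp := ?_
    won := ?_ }, m₀, rfl⟩
  · intro m hz ho
    by_cases hm : A.lab m ∈ L
    · obtain ⟨⟨w, hw⟩, hs⟩ := hL _ hm
      obtain ⟨m', rfl⟩ := hA w (hs w hw)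
      exact ⟨m', .inr ⟨hm, hw⟩⟩
    · obtain ⟨m', h⟩ := A.own m (by simp [hz, hm]) ho
      exact ⟨m', .inl ⟨hm, h⟩⟩
  · intro m hz ho w hw
    by_cases hm : A.lab m ∈ L
    · obtain ⟨m', rfl⟩ := hA w ((hL _ hm).2 w hw)
      exact ⟨m', .inr ⟨hm, hw⟩, rfl⟩
    · obtain ⟨m', h, hl⟩ := A.opp m (by simp [hz, hm]) ho w hw
      exact ⟨m', .inl ⟨hm, h⟩, hl⟩
  · intro π hπ
    by_cases hinf : ∀ N, ∃ n, N ≤ n ∧ A.lab (π n) ∈ L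
    · exact hwon _ (fun i => hedge _ _ (hπ i)) (fun i => A.lab_mem _) hinf
    · push Not at hinf
      obtain ⟨N, hN⟩ := hinf
      refine WonBy.of_shift N (A.won (fun i => π (i + N)) fun i => ?_)
      rcases hπ (i + N) with h | h
      · rw [show i + 1 + N = i + N + 1 by omega]
        exact h.2
      · exact absurd h.1 (hN _ (by omega))

end Arenas

end ParityGame

namespace ParityGame

section Strategies

universe u

variable {V : Type u} {G : ParityGame V}

namespace Arena

variable {D : Set V} (A : G.Arena 0 D ∅)

open Classical in
/-- The memory state reached from `m` when the play moves to `w`. -/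
noncomputable def move (m : A.State) (w : V) : A.State :=
  if h : ∃ m', A.next m m' ∧ A.lab m' = w then h.choose else m

/-- The memory state reached from `m₀` along a path. -/
noncomputable def memory (m₀ : A.State) (l : List V) : A.State := l.tail.foldl A.move m₀

open Classical in
/-- The strategy on paths read off from an arena. -/
noncomputable def strategy (m₀ : A.State) (l : List V) : V :=
  if h : ∃ m', A.next (A.memory m₀ l) m' ∧ l.getLast? = some (A.lab (A.memory m₀ l)) then
    A.lab h.choose
  else if h : ∃ w, ∀ x ∈ l.getLast?, G.E x w then h.choose else A.lab m₀

theorem validStrat_strategy (m₀ : A.State) : G.ValidStrat (A.strategy m₀) := by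
  intro l x _ hx _ hd
  unfold strategy
  split_ifs with h h'
  · have hlab := h.choose_spec.2
    rw [hx, Option.some_inj] at hlab
    rw [hlab]
    exact A.edge _ _ h.choose_spec.1
  · exact h'.choose_spec x hx
  · unfold DeadEnd at hd
    push Not at hd
    obtain ⟨w, hw⟩ := hd
    exact absurd ⟨w, by simpa [hx] using hw⟩ h'

theorem memory_concat {m₀ : A.State} {l : List V} {w : V}
    (hl : l.getLast? = some (A.lab (A.memory m₀ l))) (hE : G.E (A.lab (A.memory m₀ l)) w)
    (hσ : G.owner (A.lab (A.memory m₀ l)) = 0 → w = A.strategy m₀ l) :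
    A.next (A.memory m₀ l) (A.memory m₀ (l ++ [w])) ∧ A.lab (A.memory m₀ (l ++ [w])) = w := by
  have hne : l ≠ [] := by
    rintro rfl
    simp at hl
  have hmem : A.memory m₀ (l ++ [w]) = A.move (A.memory m₀ l) w := by
    simp [memory, List.tail_append_of_ne_nil hne]
  have hex : ∃ m', A.next (A.memory m₀ l) m' ∧ A.lab m' = w := by
    by_cases ho : G.owner (A.lab (A.memory m₀ l)) = 0
    · obtain ⟨m', h⟩ := A.own _ (by simp) ho
      have h' : ∃ m', A.next (A.memory m₀ l) m' ∧ l.getLast? = some (A.lab (A.memory m₀ l)) :=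
        ⟨m', h, hl⟩
      refine ⟨h'.choose, h'.choose_spec.1, ?_⟩
      rw [hσ ho, strategy, dif_pos h']
    · exact A.opp _ (by simp) ho w hE
  rw [hmem, move, dif_pos hex]
  exact hex.choose_spec

end Arena

theorem wins0_of_secures {D : Set V} {v : V} (h : G.Secures 0 D ∅ v) : G.Wins0 v := by
  obtain ⟨A, m₀, rfl⟩ := h
  refine ⟨A.strategy m₀, A.validStrat_strategy m₀, ?_, ?_⟩
  · intro π h0 hplay hconf
    let l : ℕ → List V := fun i => List.ofFn fun j : Fin (i + 1) => π j
    have hl : ∀ i, l (i + 1) = l i ++ [π (i + 1)] := fun i => List.ofFn_succ_last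
    have hlast : ∀ i, (l i).getLast? = some (π i) := by
      intro i
      cases i with
      | zero => simp [l]
      | succ i => simp [hl]
    have hlab : ∀ i, A.lab (A.memory m₀ (l i)) = π i := by
      intro i
      induction i with
      | zero => simp [l, Arena.memory, h0]
      | succ i ih =>
        rw [hl]
        exact (A.memory_concat (by rw [ih, hlast]) (by rw [ih]; exact hplay i)
          (by rw [ih]; exact hconf i)).2
    have hwon := A.won (fun i => A.memory m₀ (l i)) fun i => by
      rw [hl]
      exact (A.memory_concat (by rw [hlab, hlast]) (by rw [hlab]; exact hplay i)
          (by rw [hlab]; exact hconf i)).1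
    simp only [hlab] at hwon
    exact hwon.1 rfl
  · rintro l ⟨hhead, hchain, hdead⟩ hconf x hx
    have hne : l ≠ [] := by
      rintro rfl
      simp at hx
    have hlab : ∀ (i : ℕ) (hi : i < l.length), A.lab (A.memory m₀ (l.take (i + 1))) = l[i] := by
      intro i
      induction i with
      | zero =>
        intro hi
        obtain ⟨a, t, rfl⟩ := List.exists_cons_of_ne_nil hne
        simp at hhead
        simp [Arena.memory, hhead]
      | succ i ih =>
        intro hi
        have hi' : i < l.length := by omega
        have := ih hi'
        rw [← List.take_append_getElem hi]
        refine (A.memory_concat ?_ ?_ ?_).2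
        · rw [this, List.getLast?_take]
          simp [hi']
        · rw [this]
          exact List.isChain_iff_getElem.1 hchain i hi
        · rw [this]
          exact hconf i hi
    have hpos : 0 < l.length := List.length_pos_iff.2 hne
    have hm := hlab (l.length - 1) (by omega)
    have hxl : l[l.length - 1] = x := by
      rw [← Option.some_inj, ← hx, List.getLast?_eq_getElem?]
      simp
    rw [hxl] at hm
    by_contra ho
    have ho' : G.owner x = 0 := by omega
    obtain ⟨m', h⟩ := A.own _ (by simp) (hm ▸ ho')
    have := A.edge _ _ h
    rw [hm] at this
    exact hdead x hx _ this

theorem not_wins0_of_secures {D : Set V} {v : V} (h : G.Secures 1 D ∅ v) : ¬ G.Wins0 v := by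
  rintro ⟨σ, hvalid, hinf, hfin⟩
  obtain ⟨A, m₀, rfl⟩ := h
  let Good : List V × A.State → Prop := fun x =>
    x.1.head? = some (A.lab m₀) ∧ x.1.IsChain G.E ∧ G.ConformsFin σ x.1 ∧
      x.1.getLast? = some (A.lab x.2)
  have step : ∀ x : {x // Good x}, ∃ y : {x // Good x},
      y.1.1 = x.1.1 ++ [A.lab y.1.2] ∧ A.next x.1.2 y.1.2 ∧
        (G.owner (A.lab x.1.2) = 0 → A.lab y.1.2 = σ x.1.1) := by
    rintro ⟨⟨l, m⟩, hhead, hchain, hconf, hlast⟩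
    have hmove : ∃ m', A.next m m' ∧ (G.owner (A.lab m) = 0 → A.lab m' = σ l) := by
      by_cases ho : G.owner (A.lab m) = 1
      · obtain ⟨m', h⟩ := A.own m (by simp) ho
        exact ⟨m', h, fun h' => by rw [ho] at h'; exact absurd h' (by decide)⟩
      · have hd : ¬ G.DeadEnd (A.lab m) := fun hd =>
          ho (hfin l ⟨hhead, hchain, by simpa [hlast] using hd⟩ hconf _ hlast)
        obtain ⟨m', h, hl⟩ := A.opp m (by simp) ho (σ l)
          (hvalid l _ hchain hlast (by omega) hd)
        exact ⟨m', h, fun _ => hl⟩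
    obtain ⟨m', hnext, hσ⟩ := hmove
    have hne : l ≠ [] := by
      rintro rfl
      simp at hlast
    refine ⟨⟨(l ++ [A.lab m'], m'), ?_, ?_, ?_, ?_⟩, rfl, hnext, hσ⟩
    · simp [List.head?_append, hhead]
    · refine List.isChain_append.2 ⟨hchain, List.isChain_singleton _, ?_⟩
      intro a ha c hc
      simp only [hlast, Option.mem_some_iff] at ha
      simp at hc
      subst ha hc
      exact A.edge _ _ hnext
    · intro i hi ho
      simp only [List.length_append, List.length_singleton] at hi
      by_cases hi' : i + 1 < l.length
      · have hil : i < l.length := by omega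
        have := hconf i hi' (by simpa [List.getElem_append_left hil] using ho)
        simpa [List.getElem_append_left hi', List.take_append_of_le_length hi'.le] using this
      · have hlen : i = l.length - 1 := by omega
        have hpos : 0 < l.length := List.length_pos_iff.2 hne
        subst hlen
        have hm : l[l.length - 1] = A.lab m := by
          rw [← Option.some_inj, ← hlast, List.getLast?_eq_getElem?]
          simp
        have hidx : l.length - 1 + 1 = l.length := by omega
        have hlt : l.length - 1 < l.length := by omega
        simp only [List.get_eq_getElem, List.getElem_append_left hlt, hm] at ho
        simpa [hidx] using hσ ho
    · simp
  choose f hf using step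
  let x : ℕ → {x // Good x} := fun n =>
    f^[n] ⟨([A.lab m₀], m₀), by simp, List.isChain_singleton _, fun i h => by simp at h, by simp⟩
  have hx : ∀ n, x (n + 1) = f (x n) := fun n => Function.iterate_succ_apply' f n _
  have hl : ∀ n, (x n).1.1 = List.ofFn fun j : Fin (n + 1) => A.lab (x j).1.2 := by
    intro n
    induction n with
    | zero => simp [x]
    | succ n ih =>
      rw [List.ofFn_succ_last]
      simp only [Fin.val_castSucc, Fin.val_last]
      rw [← ih, hx]
      exact (hf (x n)).1
  have hnext : ∀ n, A.next (x n).1.2 (x (n + 1)).1.2 := fun n => by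
    rw [hx]
    exact (hf (x n)).2.1
  have hwon := A.won _ hnext
  have hwin := hinf (fun n => A.lab (x n).1.2) rfl (fun n => A.edge _ _ (hnext n)) fun n ho => by
    rw [← hl]
    simp only [hx]
    exact (hf (x n)).2.2 ho
  exact absurd (hwon.2 hwin) (by decide)

end Strategies

end ParityGame

namespace MuForm

/-- The greatest (`c = 0`) or least (`c = 1`) fixpoint formula. The index is the player who wins
the plays that unfold the formula infinitely often. -/
def fix : Fin 2 → P → MuForm P → MuForm P
  | 0, p, ψ => .nu p ψ
  | 1, p, ψ => .mu p ψ

theorem fix_inj {c c' : Fin 2} {p p' : P} {ψ ψ' : MuForm P} :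
    fix c p ψ = fix c' p' ψ' ↔ c = c' ∧ p = p' ∧ ψ = ψ' := by
  fin_cases c <;> fin_cases c' <;> simp [fix]

theorem subformulas_fix (c : Fin 2) (p : P) (ψ : MuForm P) :
    (fix c p ψ).subformulas = insert (fix c p ψ) ψ.subformulas := by
  fin_cases c <;> rfl

theorem freeVars_fix (c : Fin 2) (p : P) (ψ : MuForm P) :
    (fix c p ψ).freeVars = ψ.freeVars \ {p} := by
  fin_cases c <;> rfl

theorem fsize_fix (c : Fin 2) (p : P) (ψ : MuForm P) :
    (fix c p ψ).fsize = ψ.fsize + 1 := by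
  fin_cases c <;> rfl

theorem boundIn_iff {p : P} {φ : MuForm P} :
    BoundIn p φ ↔ ∃ c ψ, fix c p ψ ∈ φ.subformulas := by
  constructor
  · rintro ⟨ψ, h | h⟩
    exacts [⟨1, ψ, h⟩, ⟨0, ψ, h⟩]
  · rintro ⟨c, ψ, h⟩
    fin_cases c
    exacts [⟨ψ, .inr h⟩, ⟨ψ, .inl h⟩]

theorem exists_eq_fix_iff {p : P} {χ : MuForm P} :
    (∃ ψ, χ = .mu p ψ ∨ χ = .nu p ψ) ↔ ∃ c ψ, χ = fix c p ψ := by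
  constructor
  · rintro ⟨ψ, rfl | rfl⟩
    exacts [⟨1, ψ, rfl⟩, ⟨0, ψ, rfl⟩]
  · rintro ⟨c, ψ, rfl⟩
    fin_cases c
    exacts [⟨ψ, .inr rfl⟩, ⟨ψ, .inl rfl⟩]

theorem NormalForm.fix_eq {φ : MuForm P} (hnf : φ.NormalForm) {c c' : Fin 2} {p : P}
    {ψ ψ' : MuForm P} (h : fix c p ψ ∈ φ.subformulas) (h' : fix c' p ψ' ∈ φ.subformulas) :
    fix c p ψ = fix c' p ψ' :=
  hnf.1 p _ _ h h' (exists_eq_fix_iff.2 ⟨c, ψ, rfl⟩) (exists_eq_fix_iff.2 ⟨c', ψ', rfl⟩)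

theorem subformulas_trans {φ ψ χ : MuForm P} (h : χ ∈ ψ.subformulas) (h' : ψ ∈ φ.subformulas) :
    χ ∈ φ.subformulas := by
  induction φ with
  | bot | top | var | nvar =>
    simp only [subformulas, Finset.mem_singleton] at h'
    subst h'
    exact h
  | and _ _ ih₁ ih₂ | or _ _ ih₁ ih₂ =>
    simp only [subformulas, Finset.mem_insert, Finset.mem_union] at h'
    rcases h' with rfl | h' | h'
    · exact h
    · simp [subformulas, ih₁ h']
    · simp [subformulas, ih₂ h']
  | box _ ih | dia _ ih | mu _ _ ih | nu _ _ ih =>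
    simp only [subformulas, Finset.mem_insert] at h'
    rcases h' with rfl | h'
    · exact h
    · simp [subformulas, ih h']

theorem mem_subformulas_of_fix_mem {φ ψ : MuForm P} {c : Fin 2} {p : P}
    (h : fix c p ψ ∈ φ.subformulas) : ψ ∈ φ.subformulas :=
  subformulas_trans (by simp [subformulas_fix, self_mem_subformulas]) h

/-- A variable that is free in a subformula but not in the formula is bound around it. -/
theorem exists_binder {φ χ : MuForm P} {q : P} (hχ : χ ∈ φ.subformulas) (hq : q ∈ χ.freeVars)
    (hφ : q ∉ φ.freeVars) : ∃ c ψ, fix c q ψ ∈ φ.subformulas ∧ χ ∈ ψ.subformulas := by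
  induction φ with
  | bot | top | var | nvar =>
    simp only [subformulas, Finset.mem_singleton] at hχ
    subst hχ
    exact absurd hq hφ
  | and _ _ ih₁ ih₂ | or _ _ ih₁ ih₂ =>
    simp only [subformulas, Finset.mem_insert, Finset.mem_union] at hχ
    rcases hχ with rfl | h | h
    · exact absurd hq hφ
    · obtain ⟨c, ψ, h₁, h₂⟩ := ih₁ h fun h => hφ (.inl h)
      exact ⟨c, ψ, by simp [subformulas, h₁], h₂⟩
    · obtain ⟨c, ψ, h₁, h₂⟩ := ih₂ h fun h => hφ (.inr h)
      exact ⟨c, ψ, by simp [subformulas, h₁], h₂⟩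
  | box _ ih | dia _ ih =>
    simp only [subformulas, Finset.mem_insert] at hχ
    rcases hχ with rfl | h
    · exact absurd hq hφ
    · obtain ⟨c, ψ, h₁, h₂⟩ := ih h hφ
      exact ⟨c, ψ, by simp [subformulas, h₁], h₂⟩
  | mu p ψ ih =>
    simp only [subformulas, Finset.mem_insert] at hχ
    rcases hχ with rfl | h
    · exact absurd hq hφ
    · by_cases hqp : q = p
      · subst hqp
        exact ⟨1, ψ, self_mem_subformulas _, h⟩
      · obtain ⟨c, ψ, h₁, h₂⟩ := ih h fun h => hφ ⟨h, hqp⟩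
        exact ⟨c, ψ, by simp [subformulas, h₁], h₂⟩
  | nu p ψ ih =>
    simp only [subformulas, Finset.mem_insert] at hχ
    rcases hχ with rfl | h
    · exact absurd hq hφ
    · by_cases hqp : q = p
      · subst hqp
        exact ⟨0, ψ, self_mem_subformulas _, h⟩
      · obtain ⟨c, ψ, h₁, h₂⟩ := ih h fun h => hφ ⟨h, hqp⟩
        exact ⟨c, ψ, by simp [subformulas, h₁], h₂⟩

theorem NormalForm.mem_subformulas_body {φ χ ψ : MuForm P} (hnf : φ.NormalForm) {c : Fin 2}
    {p : P} (hfix : fix c p ψ ∈ φ.subformulas) (hχ : χ ∈ φ.subformulas) (hp : p ∈ χ.freeVars) :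
    χ ∈ ψ.subformulas := by
  obtain ⟨c', ψ', h, h'⟩ := exists_binder hχ hp fun h =>
    hnf.2 p h (boundIn_iff.2 ⟨c, ψ, hfix⟩)
  obtain ⟨-, -, rfl⟩ := fix_inj.1 (hnf.fix_eq hfix h)
  exact h'

theorem boundIn_of_positiveIn {χ : MuForm P} {q : P} (hpos : χ.PositiveIn q)
    (h : .nvar q ∈ χ.subformulas) : BoundIn q χ := by
  rw [boundIn_iff]
  induction χ with
  | bot | top | var => simp [subformulas] at h
  | nvar p =>
    simp only [subformulas, Finset.mem_singleton, nvar.injEq] at h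
    exact absurd h.symm hpos
  | and _ _ ih₁ ih₂ | or _ _ ih₁ ih₂ =>
    simp only [subformulas, Finset.mem_insert, Finset.mem_union, reduceCtorEq, false_or] at h
    rcases h with h | h
    · obtain ⟨c, ψ, h⟩ := ih₁ hpos.1 h
      exact ⟨c, ψ, by simp [subformulas, h]⟩
    · obtain ⟨c, ψ, h⟩ := ih₂ hpos.2 h
      exact ⟨c, ψ, by simp [subformulas, h]⟩
  | box _ ih | dia _ ih =>
    simp only [subformulas, Finset.mem_insert, reduceCtorEq, false_or] at h
    obtain ⟨c, ψ, h⟩ := ih hpos h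
    exact ⟨c, ψ, by simp [subformulas, h]⟩
  | mu p ψ ih =>
    simp only [subformulas, Finset.mem_insert, reduceCtorEq, false_or] at h
    rcases hpos with rfl | hpos
    · exact ⟨1, ψ, self_mem_subformulas _⟩
    · obtain ⟨c, ψ, h⟩ := ih hpos h
      exact ⟨c, ψ, by simp [subformulas, h]⟩
  | nu p ψ ih =>
    simp only [subformulas, Finset.mem_insert, reduceCtorEq, false_or] at h
    rcases hpos with rfl | hpos
    · exact ⟨0, ψ, self_mem_subformulas _⟩
    · obtain ⟨c, ψ, h⟩ := ih hpos h
      exact ⟨c, ψ, by simp [subformulas, h]⟩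

theorem NormalForm.not_boundIn_of_nvar_mem {φ : MuForm P} (hnf : φ.NormalForm)
    (hpos : ∀ (p : P) (ψ : MuForm P), (.mu p ψ ∈ φ.subformulas ∨ .nu p ψ ∈ φ.subformulas) →
      ψ.PositiveIn p) {q : P} (hq : .nvar q ∈ φ.subformulas) : ¬ BoundIn q φ := by
  intro hb
  obtain ⟨c, ψ, hfix⟩ := boundIn_iff.1 hb
  have hmem := hnf.mem_subformulas_body hfix hq rfl
  have hψ : ψ.PositiveIn q := hpos q ψ (by fin_cases c; exacts [.inr hfix, .inl hfix])
  obtain ⟨c', ψ', h⟩ := boundIn_iff.1 (boundIn_of_positiveIn hψ hmem)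
  have := fsize_le_of_mem_subformulas h
  rw [← hnf.fix_eq hfix (subformulas_trans h (mem_subformulas_of_fix_mem hfix)),
    fsize_fix] at this
  omega

theorem alt_fix_pos (c : Fin 2) (p : P) (ψ : MuForm P) : 1 ≤ (fix c p ψ).alt := by
  fin_cases c <;> simp [fix, alt]

theorem alt_le_of_mem_subformulas {φ ψ : MuForm P} (h : ψ ∈ φ.subformulas) : ψ.alt ≤ φ.alt := by
  induction φ with
  | bot | top | var | nvar =>
    simp only [subformulas, Finset.mem_singleton] at h
    rw [h]
  | and _ _ ih₁ ih₂ | or _ _ ih₁ ih₂ =>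
    simp only [subformulas, Finset.mem_insert, Finset.mem_union] at h
    rcases h with rfl | h | h
    · rfl
    · exact (ih₁ h).trans (by simp [alt])
    · exact (ih₂ h).trans (by simp [alt])
  | box _ ih | dia _ ih | mu _ _ ih | nu _ _ ih =>
    simp only [subformulas, Finset.mem_insert] at h
    rcases h with rfl | h
    · rfl
    · exact (ih h).trans (by simp [alt])

theorem alt_fix_lt {c c' : Fin 2} (hc : c' ≠ c) {p q : P} {ψ χ : MuForm P}
    (h : fix c' q χ ∈ ψ.subformulas) (hp : p ∈ (fix c' q χ).freeVars) :
    (fix c' q χ).alt < (fix c p ψ).alt := by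
  classical
  fin_cases c <;> fin_cases c' <;> first | exact absurd rfl hc | skip
  · simp only [fix] at h hp ⊢
    rw [Nat.lt_iff_add_one_le, alt.eq_def (.nu p ψ)]
    refine le_max_of_le_right ?_
    refine le_trans ?_ (Finset.le_sup (Finset.mem_attach _ ⟨_, h⟩))
    rw [if_pos ⟨⟨q, χ, rfl⟩, hp⟩]
  · simp only [fix] at h hp ⊢
    rw [Nat.lt_iff_add_one_le, alt.eq_def (.mu p ψ)]
    refine le_max_of_le_right ?_
    refine le_trans ?_ (Finset.le_sup (Finset.mem_attach _ ⟨_, h⟩))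
    rw [if_pos ⟨⟨q, χ, rfl⟩, hp⟩]

theorem even_mcPrio_fix (c : Fin 2) (p : P) (ψ : MuForm P) :
    c = 0 ↔ Even (mcPrio (fix c p ψ)) := by
  have := alt_fix_pos c p ψ
  fin_cases c
  · simp only [fix, mcPrio] at this ⊢
    rw [if_pos (by omega)]
    simp
  · simp only [fix, mcPrio] at this ⊢
    rw [if_pos (by omega), Nat.even_iff]
    simp only [Fin.mk_one, one_ne_zero, false_iff]
    omega

theorem mcPrio_fix_lt {c c' : Fin 2} (hc : c' ≠ c) {p q : P} {ψ χ : MuForm P}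
    (h : (fix c' q χ).alt < (fix c p ψ).alt) : mcPrio (fix c' q χ) < mcPrio (fix c p ψ) := by
  have := alt_fix_pos c p ψ
  have := alt_fix_pos c' q χ
  fin_cases c <;> fin_cases c' <;> first | exact absurd rfl hc | skip
  all_goals
    simp only [fix, mcPrio, Fin.zero_eta, Fin.mk_one] at *
    rw [if_pos (by omega), if_pos (by omega)]
    omega

theorem mcPrio_eq_zero_or_eq_fix (χ : MuForm P) :
    mcPrio χ = 0 ∨ ∃ c q ψ, χ = fix c q ψ := by
  cases χ with
  | mu p ψ => exact .inr ⟨1, p, ψ, rfl⟩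
  | nu p ψ => exact .inr ⟨0, p, ψ, rfl⟩
  | _ => exact .inl rfl

/-- `p` is free in the formula, possibly after expanding bound variables of `φ`. -/
inductive DependsOn (φ : MuForm P) (p : P) : MuForm P → Prop
  | free {χ} : p ∈ χ.freeVars → DependsOn φ p χ
  | expand {χ ψ c q} : q ∈ χ.freeVars → fix c q ψ ∈ φ.subformulas → DependsOn φ p (fix c q ψ) →
      DependsOn φ p χ

theorem NormalForm.alt_le_of_free {φ ψ χ : MuForm P} (hnf : φ.NormalForm) {c c' : Fin 2}
    {p q : P} (hfix : fix c p ψ ∈ φ.subformulas) (hχ : fix c' q χ ∈ φ.subformulas)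
    (h : p ∈ (fix c' q χ).freeVars) :
    (fix c' q χ).alt ≤ (fix c p ψ).alt ∧ (c' ≠ c → (fix c' q χ).alt < (fix c p ψ).alt) := by
  have hmem := hnf.mem_subformulas_body hfix hχ h
  exact ⟨alt_le_of_mem_subformulas (by simp [subformulas_fix, hmem]),
    fun hc => alt_fix_lt hc hmem h⟩

theorem DependsOn.alt_le {φ ψ χ : MuForm P} (hnf : φ.NormalForm) {c c' : Fin 2}
    {p q : P} (h : DependsOn φ p (fix c' q χ)) (hfix : fix c p ψ ∈ φ.subformulas)
    (hχ : fix c' q χ ∈ φ.subformulas) :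
    (fix c' q χ).alt ≤ (fix c p ψ).alt ∧ (c' ≠ c → (fix c' q χ).alt < (fix c p ψ).alt) := by
  generalize hθ : fix c' q χ = θ at h
  induction h generalizing c' q χ with
  | free h =>
    subst hθ
    exact hnf.alt_le_of_free hfix hχ h
  | @expand _ ρ d r hr hρ _ ih =>
    subst hθ
    have h₁ := hnf.alt_le_of_free hρ hχ hr
    have h₂ := ih hρ rfl
    refine ⟨h₁.1.trans h₂.1, fun hc => ?_⟩
    by_cases hd : c' = d
    · exact h₁.1.trans_lt (h₂.2 (hd ▸ hc))
    · exact (h₁.2 hd).trans_le h₂.1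

theorem DependsOn.of_edge {φ ψ : MuForm P} (hnf : φ.NormalForm) {c : Fin 2} {p : P}
    {R : S → S → Prop} {χ χ' : MuForm P} {s s' : S} (h : DependsOn φ p χ')
    (hE : mcEdge R φ (χ, s) (χ', s')) (hfix : fix c p ψ ∈ φ.subformulas)
    (hχ : χ ∈ φ.subformulas) (hne : χ ≠ fix c p ψ) : DependsOn φ p χ := by
  have of_subset : χ'.freeVars ⊆ χ.freeVars → DependsOn φ p χ := by
    intro hsub
    cases h with
    | free h => exact .free (hsub h)
    | expand h₁ h₂ h₃ => exact .expand (hsub h₁) h₂ h₃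
  have of_fix : ∀ d q, χ = fix d q χ' → DependsOn φ p χ := by
    rintro d q rfl
    cases h with
    | free h =>
      refine .free ?_
      rw [freeVars_fix]
      refine ⟨h, ?_⟩
      rintro rfl
      exact hne (hnf.fix_eq hχ hfix)
    | @expand _ ρ e r h₁ h₂ h₃ =>
      by_cases hr : r = q
      · subst hr
        rwa [hnf.fix_eq hχ h₂]
      · refine .expand ?_ h₂ h₃
        rw [freeVars_fix]
        exact ⟨h₁, hr⟩
  cases χ with
  | bot | top | nvar => exact hE.elim
  | var q =>
    obtain ⟨-, h₁, h₂⟩ := hE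
    obtain ⟨d, ρ, rfl⟩ := exists_eq_fix_iff.1 h₂
    exact .expand rfl h₁ h
  | and | or =>
    obtain ⟨-, h | h⟩ := hE
    · obtain rfl : χ' = _ := h
      exact of_subset Set.subset_union_left
    · obtain rfl : χ' = _ := h
      exact of_subset Set.subset_union_right
  | box | dia =>
    obtain rfl : χ' = _ := hE.1
    exact of_subset subset_rfl
  | mu q =>
    obtain rfl : χ' = _ := hE.2
    exact of_fix 1 q rfl
  | nu q =>
    obtain rfl : χ' = _ := hE.2
    exact of_fix 0 q rfl

end MuForm

section ModelChecking

open MuForm ParityGame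

variable {R : S → S → Prop} {φ : MuForm P} {κ : P → Set S} {b : Fin 2}

theorem mcGame_owner_eq_iff {v : {ψ : MuForm P // ψ ∈ φ.subformulas} × S} :
    (mcGame R φ κ).owner v = b ↔ (b = 0 ↔ mcPlayer0 φ κ (v.1.1, v.2)) := by
  fin_cases b <;> simp [mcGame]

/-- If a play stays inside a fixpoint formula and visits its variable infinitely often, then every
position not carrying the fixpoint formula depends on the variable. -/
theorem eq_fix_or_dependsOn (hnf : φ.NormalForm) {c : Fin 2} {p : P} {ψ : MuForm P}
    (hfix : fix c p ψ ∈ φ.subformulas) {π : ℕ → {ψ : MuForm P // ψ ∈ φ.subformulas} × S}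
    (hplay : (mcGame R φ κ).InfPlay π) (hsub : ∀ i, (π i).1.1 ∈ (fix c p ψ).subformulas)
    (hinf : ∀ N, ∃ n, N ≤ n ∧ (π n).1.1 = .var p) (n : ℕ) :
    (π n).1.1 = fix c p ψ ∨ DependsOn φ p (π n).1.1 := by
  have back : ∀ k n, (π (n + k)).1.1 = .var p →
      (π n).1.1 = fix c p ψ ∨ DependsOn φ p (π n).1.1 := by
    intro k
    induction k with
    | zero =>
      intro n h
      exact .inr (.free (by rw [Nat.add_zero] at h; rw [h]; rfl))
    | succ k ih =>
      intro n h
      by_cases hn : (π n).1.1 = fix c p ψ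
      · exact .inl hn
      right
      have hE : mcEdge R φ ((π n).1.1, (π n).2) ((π (n + 1)).1.1, (π (n + 1)).2) := hplay n
      rcases ih (n + 1) (by rwa [show n + 1 + k = n + (k + 1) by omega]) with hfp | hdep
      · have hsize := fsize_le_of_mem_subformulas (hsub n)
        rw [hfp] at hE
        generalize (π n).1.1 = χ at hE hsize
        cases χ with
        | bot | top | nvar => exact hE.elim
        | var q =>
          obtain ⟨-, -, h⟩ := hE
          obtain ⟨d, ρ, h⟩ := exists_eq_fix_iff.1 h
          obtain ⟨-, rfl, -⟩ := fix_inj.1 h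
          exact .free rfl
        | and | or =>
          obtain ⟨-, h | h⟩ := hE
          all_goals
            have h : fix c p ψ = _ := h
            rw [h] at hsize
            simp only [fsize] at hsize
            omega
        | box | dia =>
          have h : fix c p ψ = _ := hE.1
          rw [h] at hsize
          simp [fsize] at hsize
        | mu | nu =>
          have h : fix c p ψ = _ := hE.2
          rw [h] at hsize
          simp [fsize] at hsize
      · exact hdep.of_edge hnf hE hfix (π n).1.2 hn
  obtain ⟨m, hm, h⟩ := hinf n
  exact back (m - n) n (by rwa [show n + (m - n) = m by omega])

/-- A play that stays inside a fixpoint formula and unfolds it infinitely often is won by the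
player in charge of the fixpoint. -/
theorem wonBy_of_unfold_infinitely_often (hnf : φ.NormalForm) {p : P} {ψ : MuForm P}
    (hfix : fix b p ψ ∈ φ.subformulas) {π : ℕ → {ψ : MuForm P // ψ ∈ φ.subformulas} × S}
    (hplay : (mcGame R φ κ).InfPlay π) (hsub : ∀ i, (π i).1.1 ∈ (fix b p ψ).subformulas)
    (hinf : ∀ N, ∃ n, N ≤ n ∧ (π n).1.1 = .var p) : (mcGame R φ κ).WonBy b π := by
  have hmem : mcPrio (fix b p ψ) ∈ (mcGame R φ κ).InfOften π := by
    intro N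
    obtain ⟨n, hn, h⟩ := hinf N
    refine ⟨n + 1, by omega, ?_⟩
    have hE : mcEdge R φ ((π n).1.1, (π n).2) ((π (n + 1)).1.1, (π (n + 1)).2) := hplay n
    rw [h] at hE
    obtain ⟨-, h₁, h₂⟩ := hE
    obtain ⟨d, ρ, h₂⟩ := exists_eq_fix_iff.1 h₂
    simp only at h₁ h₂
    rw [h₂] at h₁
    show mcPrio (π (n + 1)).1.1 = _
    rw [h₂, hnf.fix_eq h₁ hfix]
  have hbdd : BddAbove ((mcGame R φ κ).InfOften π) := by
    refine ((mcGame R φ κ).finRange.subset ?_).bddAbove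
    intro c hc
    obtain ⟨n, -, h⟩ := hc 0
    exact ⟨_, h⟩
  have hle := le_csSup hbdd hmem
  obtain ⟨n, -, hn⟩ := Nat.sSup_mem ⟨_, hmem⟩ hbdd 0
  unfold WonBy WinInf
  rw [← hn] at hle ⊢
  change mcPrio _ ≤ mcPrio (π n).1.1 at hle
  change b = 0 ↔ Even (mcPrio (π n).1.1)
  have hsubn := (π n).1.2
  have hcases := eq_fix_or_dependsOn hnf hfix hplay hsub hinf n
  generalize (π n).1.1 = χ at hle hcases hsubn
  rcases mcPrio_eq_zero_or_eq_fix χ with h0 | ⟨c, q, ρ, rfl⟩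
  · rw [h0] at hle ⊢
    rw [even_mcPrio_fix b p ψ, Nat.le_zero.1 hle]
  · rcases hcases with h | h
    · rw [h]
      exact even_mcPrio_fix b p ψ
    · by_cases hc : c = b
      · subst hc
        exact even_mcPrio_fix c q ρ
      · exact absurd hle (not_le.2 (mcPrio_fix_lt hc ((h.alt_le hnf hfix hsubn).2 hc)))

/-- The positions of the game for `φ` that belong to the subformula `ψ`. -/
def inside (S : Type*) (φ ψ : MuForm P) : Set ({ψ : MuForm P // ψ ∈ φ.subformulas} × S) :=
  {v | v.1.1 ∈ ψ.subformulas}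

/-- The positions carrying a free variable of `ψ` bound in `φ` whose value under `κ'` favours
player `b`. -/
def goodLeaves (φ : MuForm P) (b : Fin 2) (ψ : MuForm P) (κ' : P → Set S) :
    Set ({ψ : MuForm P // ψ ∈ φ.subformulas} × S) :=
  {v | ∃ q, v.1.1 = .var q ∧ q ∈ ψ.freeVars ∧ BoundIn q φ ∧ (b = 0 ↔ v.2 ∈ κ' q)}

theorem inside_mono {ψ χ : MuForm P} (h : χ ∈ ψ.subformulas) : inside S φ χ ⊆ inside S φ ψ :=
  fun _ hv => subformulas_trans hv h

theorem goodLeaves_mono {ψ χ : MuForm P} (h : χ.freeVars ⊆ ψ.freeVars) (κ' : P → Set S) :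
    goodLeaves φ b χ κ' ⊆ goodLeaves φ b ψ κ' := by
  rintro v ⟨q, h₁, h₂, h₃⟩
  exact ⟨q, h₁, h h₂, h₃⟩

theorem goodLeaves_update_subset (c : Fin 2) (p : P) (ψ : MuForm P) (κ' : P → Set S) (X : Set S) :
    goodLeaves φ b ψ (Function.update κ' p X) ⊆
      goodLeaves φ b (fix c p ψ) κ' ∪ {v | v.1.1 = .var p ∧ (b = 0 ↔ v.2 ∈ X)} := by
  rintro v ⟨q, h₁, h₂, h₃, h₄⟩
  by_cases hq : q = p
  · subst hq
    exact .inr ⟨h₁, by simpa using h₄⟩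
  · refine .inl ⟨q, h₁, ?_, h₃, by simpa [hq] using h₄⟩
    rw [freeVars_fix]
    exact ⟨h₂, hq⟩

theorem mcGame_edge_fix {c : Fin 2} {p : P} {ψ : MuForm P} (hfix : fix c p ψ ∈ φ.subformulas)
    (s : S) (w : {ψ : MuForm P // ψ ∈ φ.subformulas} × S) :
    (mcGame R φ κ).E (⟨fix c p ψ, hfix⟩, s) w ↔
      w = (⟨ψ, mem_subformulas_of_fix_mem hfix⟩, s) := by
  rw [Prod.ext_iff, Subtype.ext_iff, and_comm]
  fin_cases c <;> rfl

theorem mcGame_edge_var (hnf : φ.NormalForm) {c : Fin 2} {p : P} {ψ : MuForm P}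
    (hfix : fix c p ψ ∈ φ.subformulas) {v : {ψ : MuForm P // ψ ∈ φ.subformulas} × S}
    (hv : v.1.1 = .var p) (w : {ψ : MuForm P // ψ ∈ φ.subformulas} × S) :
    (mcGame R φ κ).E v w ↔ w = (⟨fix c p ψ, hfix⟩, v.2) := by
  obtain ⟨⟨_, hmem⟩, s⟩ := v
  obtain rfl : _ = MuForm.var p := hv
  obtain ⟨⟨χ, hχ⟩, t⟩ := w
  simp only [mcGame, mcEdge, exists_eq_fix_iff, Prod.mk.injEq, Subtype.mk.injEq]
  constructor
  · rintro ⟨h, -, d, ρ, rfl⟩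
    exact ⟨hnf.fix_eq hχ hfix, h⟩
  · rintro ⟨rfl, h⟩
    exact ⟨h, hfix, c, ψ, rfl⟩

theorem secures_fix_of_body {c : Fin 2} {p : P} {ψ : MuForm P}
    (hfix : fix c p ψ ∈ φ.subformulas) {Z : Set ({ψ : MuForm P // ψ ∈ φ.subformulas} × S)} {s : S}
    (h : (mcGame R φ κ).Secures b (inside S φ (fix c p ψ)) Z
      (⟨ψ, mem_subformulas_of_fix_mem hfix⟩, s)) :
    (mcGame R φ κ).Secures b (inside S φ (fix c p ψ)) Z (⟨fix c p ψ, hfix⟩, s) := by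
  refine .of_forall (self_mem_subformulas _) (fun _ => ⟨_, (mcGame_edge_fix hfix s _).2 rfl⟩) ?_
  intro w hw
  rwa [(mcGame_edge_fix hfix s w).1 hw]

theorem inside_body_subset (c : Fin 2) (p : P) (ψ : MuForm P) :
    inside S φ ψ ⊆ inside S φ (fix c p ψ) :=
  inside_mono (by simp [subformulas_fix, self_mem_subformulas])

theorem secures_fix_of_unfold (hnf : φ.NormalForm) {c : Fin 2} {p : P} {ψ : MuForm P}
    (hfix : fix c p ψ ∈ φ.subformulas) {κ' : P → Set S} {X : Set S} {s : S}
    (h : (mcGame R φ κ).Secures b (inside S φ ψ) (goodLeaves φ b ψ (Function.update κ' p X))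
      (⟨ψ, mem_subformulas_of_fix_mem hfix⟩, s))
    (hX : ∀ x, (b = 0 ↔ x ∈ X) → (mcGame R φ κ).Secures b (inside S φ (fix c p ψ))
      (goodLeaves φ b (fix c p ψ) κ') (⟨fix c p ψ, hfix⟩, x)) :
    (mcGame R φ κ).Secures b (inside S φ (fix c p ψ)) (goodLeaves φ b (fix c p ψ) κ')
      (⟨fix c p ψ, hfix⟩, s) := by
  refine secures_fix_of_body hfix ((h.mono (inside_body_subset c p ψ)
    (goodLeaves_update_subset c p ψ κ' X)).bind ?_)
  rintro z hz (hZ | ⟨hp, hx⟩)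
  · exact .of_mem hz hZ
  · refine .of_forall hz (fun _ => ⟨_, (mcGame_edge_var hnf hfix hp _).2 rfl⟩) ?_
    intro w hw
    rw [(mcGame_edge_var hnf hfix hp w).1 hw]
    exact hX _ hx

theorem secures_fix_of_invariant (hnf : φ.NormalForm) {p : P} {ψ : MuForm P}
    (hfix : fix b p ψ ∈ φ.subformulas) {κ' : P → Set S} {X : Set S}
    (h : ∀ x, (b = 0 ↔ x ∈ X) → (mcGame R φ κ).Secures b (inside S φ ψ)
      (goodLeaves φ b ψ (Function.update κ' p X)) (⟨ψ, mem_subformulas_of_fix_mem hfix⟩, x))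
    {s : S} (hs : b = 0 ↔ s ∈ X) :
    (mcGame R φ κ).Secures b (inside S φ (fix b p ψ)) (goodLeaves φ b (fix b p ψ) κ')
      (⟨fix b p ψ, hfix⟩, s) := by
  have hbody : ∀ x, (b = 0 ↔ x ∈ X) → (mcGame R φ κ).Secures b (inside S φ (fix b p ψ))
      (goodLeaves φ b (fix b p ψ) κ' ∪ {v | v.1.1 = .var p ∧ (b = 0 ↔ v.2 ∈ X)})
      (⟨fix b p ψ, hfix⟩, x) := fun x hx =>
    secures_fix_of_body hfix ((h x hx).mono (inside_body_subset b p ψ)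
      (goodLeaves_update_subset b p ψ κ' X))
  refine (hbody s hs).loop ?_ ?_
  · rintro l ⟨hp, hx⟩
    refine ⟨⟨_, (mcGame_edge_var hnf hfix hp _).2 rfl⟩, fun w hw => ?_⟩
    rw [(mcGame_edge_var hnf hfix hp w).1 hw]
    exact hbody _ hx
  · intro π hplay hD hL
    refine wonBy_of_unfold_infinitely_often hnf hfix hplay hD fun N => ?_
    obtain ⟨n, hn, h⟩ := hL N
    exact ⟨n, hn, h.1⟩

/-- The player favoured by the truth value of `ψ` at `s` secures the position `(ψ, s)`. -/
theorem secures_of_sem (hnf : φ.NormalForm)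
    (hpos : ∀ (p : P) (ψ : MuForm P), (.mu p ψ ∈ φ.subformulas ∨ .nu p ψ ∈ φ.subformulas) →
      ψ.PositiveIn p) {ψ : MuForm P} (hψ : ψ ∈ φ.subformulas) {κ' : P → Set S}
    (hκ : ∀ q ∈ φ.freeVars, κ' q = κ q) {s : S} (hs : b = 0 ↔ s ∈ ψ.sem R κ') :
    (mcGame R φ κ).Secures b (inside S φ ψ) (goodLeaves φ b ψ κ') (⟨ψ, hψ⟩, s) := by
  have hself : ∀ {χ} (hχ : χ ∈ φ.subformulas) (t : S),
      ((⟨χ, hχ⟩, t) : {ψ : MuForm P // ψ ∈ φ.subformulas} × S) ∈ inside S φ χ :=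
    fun _ _ => self_mem_subformulas _
  have free_of_not_bound : ∀ {χ}, χ ∈ φ.subformulas → ∀ q ∈ χ.freeVars, ¬ BoundIn q φ →
      q ∈ φ.freeVars := by
    intro χ hχ q hq hb
    by_contra hqφ
    obtain ⟨c, ρ, h, -⟩ := exists_binder hχ hq hqφ
    exact hb (boundIn_iff.2 ⟨c, ρ, h⟩)
  have agree : ∀ {c p χ}, fix c p χ ∈ φ.subformulas → ∀ {κ' : P → Set S},
      (∀ q ∈ φ.freeVars, κ' q = κ q) →
      ∀ X, ∀ q ∈ φ.freeVars, Function.update κ' p X q = κ q := by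
    intro c p χ hfix κ' hκ X q hq
    have hqp : q ≠ p := by
      rintro rfl
      exact hnf.2 q hq (boundIn_iff.2 ⟨c, χ, hfix⟩)
    rw [Function.update_of_ne hqp, hκ q hq]
  have hb : b = 0 ∨ b = 1 := by omega
  induction ψ generalizing κ' s with
  | bot =>
    refine .of_forall (hself hψ s) (fun ho => ?_) fun w hw => hw.elim
    have := mcGame_owner_eq_iff.1 ho
    simp_all [mcPlayer0, sem]
  | top =>
    refine .of_forall (hself hψ s) (fun ho => ?_) fun w hw => hw.elim
    have := mcGame_owner_eq_iff.1 ho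
    simp_all [mcPlayer0, sem]
  | nvar q =>
    refine .of_forall (hself hψ s) (fun ho => ?_) fun w hw => hw.elim
    have hbound := hnf.not_boundIn_of_nvar_mem hpos hψ
    have := mcGame_owner_eq_iff.1 ho
    have := hκ q (free_of_not_bound hψ q rfl hbound)
    simp_all [mcPlayer0, sem]
  | var q =>
    by_cases hbound : BoundIn q φ
    · exact .of_mem (hself hψ s) ⟨q, rfl, rfl, hbound, hs⟩
    · have hq := free_of_not_bound hψ q rfl hbound
      refine .of_forall (hself hψ s) (fun ho => ?_) fun w hw => ?_
      · have := mcGame_owner_eq_iff.1 ho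
        have := hκ q hq
        simp_all [mcPlayer0, sem]
      · obtain ⟨-, h₁, h₂⟩ := hw
        obtain ⟨c, χ, h₂⟩ := exists_eq_fix_iff.1 h₂
        exact absurd (boundIn_iff.2 ⟨c, χ, h₂ ▸ h₁⟩) hbound
  | and ψ₁ ψ₂ ih₁ ih₂ =>
    have h₁ : ψ₁ ∈ (and ψ₁ ψ₂).subformulas := by simp [subformulas, self_mem_subformulas]
    have h₂ : ψ₂ ∈ (and ψ₁ ψ₂).subformulas := by simp [subformulas, self_mem_subformulas]
    have left : (b = 0 ↔ s ∈ ψ₁.sem R κ') → (mcGame R φ κ).Secures b (inside S φ (and ψ₁ ψ₂))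
        (goodLeaves φ b (and ψ₁ ψ₂) κ') (⟨ψ₁, subformulas_trans h₁ hψ⟩, s) := fun h =>
      (ih₁ _ hκ h).mono (inside_mono h₁) (goodLeaves_mono Set.subset_union_left κ')
    have right : (b = 0 ↔ s ∈ ψ₂.sem R κ') → (mcGame R φ κ).Secures b (inside S φ (and ψ₁ ψ₂))
        (goodLeaves φ b (and ψ₁ ψ₂) κ') (⟨ψ₂, subformulas_trans h₂ hψ⟩, s) := fun h =>
      (ih₂ _ hκ h).mono (inside_mono h₂) (goodLeaves_mono Set.subset_union_right κ')
    obtain rfl | rfl := hb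
    · simp only [sem, true_iff] at hs
      refine .of_forall (hself hψ s) (fun ho => ?_) ?_
      · have := mcGame_owner_eq_iff.1 ho
        simp [mcPlayer0] at this
      · rintro ⟨⟨χ, hχ⟩, t⟩ ⟨ht, hw⟩
        obtain rfl : t = s := ht
        rcases hw with hw | hw
        · obtain rfl : χ = ψ₁ := hw
          exact left (by simp [hs.1])
        · obtain rfl : χ = ψ₂ := hw
          exact right (by simp [hs.2])
    · simp only [sem, one_ne_zero, false_iff] at hs
      rw [Set.mem_inter_iff, not_and_or] at hs
      have ho := mcGame_owner_eq_iff (R := R) (κ := κ) (b := 1) (v := (⟨_, hψ⟩, s)) |>.2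
        (by simp [mcPlayer0])
      rcases hs with hs | hs
      · exact .of_own (w := (⟨ψ₁, subformulas_trans h₁ hψ⟩, s)) (hself hψ s) ho
          ⟨rfl, .inl rfl⟩ (left (by simp [hs]))
      · exact .of_own (w := (⟨ψ₂, subformulas_trans h₂ hψ⟩, s)) (hself hψ s) ho
          ⟨rfl, .inr rfl⟩ (right (by simp [hs]))
  | or ψ₁ ψ₂ ih₁ ih₂ =>
    have h₁ : ψ₁ ∈ (or ψ₁ ψ₂).subformulas := by simp [subformulas, self_mem_subformulas]
    have h₂ : ψ₂ ∈ (or ψ₁ ψ₂).subformulas := by simp [subformulas, self_mem_subformulas]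
    have left : (b = 0 ↔ s ∈ ψ₁.sem R κ') → (mcGame R φ κ).Secures b (inside S φ (or ψ₁ ψ₂))
        (goodLeaves φ b (or ψ₁ ψ₂) κ') (⟨ψ₁, subformulas_trans h₁ hψ⟩, s) := fun h =>
      (ih₁ _ hκ h).mono (inside_mono h₁) (goodLeaves_mono Set.subset_union_left κ')
    have right : (b = 0 ↔ s ∈ ψ₂.sem R κ') → (mcGame R φ κ).Secures b (inside S φ (or ψ₁ ψ₂))
        (goodLeaves φ b (or ψ₁ ψ₂) κ') (⟨ψ₂, subformulas_trans h₂ hψ⟩, s) := fun h =>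
      (ih₂ _ hκ h).mono (inside_mono h₂) (goodLeaves_mono Set.subset_union_right κ')
    obtain rfl | rfl := hb
    · simp only [sem, true_iff] at hs
      have ho := mcGame_owner_eq_iff (R := R) (κ := κ) (b := 0) (v := (⟨_, hψ⟩, s)) |>.2
        (by simp [mcPlayer0])
      rcases hs with hs | hs
      · exact .of_own (w := (⟨ψ₁, subformulas_trans h₁ hψ⟩, s)) (hself hψ s) ho
          ⟨rfl, .inl rfl⟩ (left (by simp [hs]))
      · exact .of_own (w := (⟨ψ₂, subformulas_trans h₂ hψ⟩, s)) (hself hψ s) ho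
          ⟨rfl, .inr rfl⟩ (right (by simp [hs]))
    · simp only [sem, one_ne_zero, false_iff] at hs
      rw [Set.mem_union, not_or] at hs
      refine .of_forall (hself hψ s) (fun ho => ?_) ?_
      · have := mcGame_owner_eq_iff.1 ho
        simp [mcPlayer0] at this
      · rintro ⟨⟨χ, hχ⟩, t⟩ ⟨ht, hw⟩
        obtain rfl : t = s := ht
        rcases hw with hw | hw
        · obtain rfl : χ = ψ₁ := hw
          exact left (by simp [hs.1])
        · obtain rfl : χ = ψ₂ := hw
          exact right (by simp [hs.2])
  | box χ ih =>
    have hχ : χ ∈ (box χ).subformulas := by simp [subformulas, self_mem_subformulas]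
    have child : ∀ t, (b = 0 ↔ t ∈ χ.sem R κ') →
        (mcGame R φ κ).Secures b (inside S φ (box χ)) (goodLeaves φ b (box χ) κ')
          (⟨χ, subformulas_trans hχ hψ⟩, t) := fun t h =>
      (ih _ hκ h).mono (inside_mono hχ) (goodLeaves_mono subset_rfl κ')
    obtain rfl | rfl := hb
    · simp only [sem, true_iff, Set.mem_ofPred_eq] at hs
      refine .of_forall (hself hψ s) (fun ho => ?_) ?_
      · have := mcGame_owner_eq_iff.1 ho
        simp [mcPlayer0] at this
      · rintro ⟨⟨ρ, hρ⟩, t⟩ ⟨hw, ht⟩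
        obtain rfl : ρ = χ := hw
        exact child t (by simp [hs t ht])
    · simp only [sem, one_ne_zero, false_iff, Set.mem_ofPred_eq] at hs
      push Not at hs
      have ho := mcGame_owner_eq_iff (R := R) (κ := κ) (b := 1) (v := (⟨_, hψ⟩, s)) |>.2
        (by simp [mcPlayer0])
      obtain ⟨t, ht, h⟩ := hs
      exact .of_own (hself hψ s) ho ⟨rfl, ht⟩ (child t (by simp [h]))
  | dia χ ih =>
    have hχ : χ ∈ (dia χ).subformulas := by simp [subformulas, self_mem_subformulas]
    have child : ∀ t, (b = 0 ↔ t ∈ χ.sem R κ') →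
        (mcGame R φ κ).Secures b (inside S φ (dia χ)) (goodLeaves φ b (dia χ) κ')
          (⟨χ, subformulas_trans hχ hψ⟩, t) := fun t h =>
      (ih _ hκ h).mono (inside_mono hχ) (goodLeaves_mono subset_rfl κ')
    obtain rfl | rfl := hb
    · simp only [sem, true_iff, Set.mem_ofPred_eq] at hs
      have ho := mcGame_owner_eq_iff (R := R) (κ := κ) (b := 0) (v := (⟨_, hψ⟩, s)) |>.2
        (by simp [mcPlayer0])
      obtain ⟨t, ht, h⟩ := hs
      exact .of_own (hself hψ s) ho ⟨rfl, ht⟩ (child t (by simp [h]))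
    · simp only [sem, one_ne_zero, false_iff, Set.mem_ofPred_eq] at hs
      push Not at hs
      refine .of_forall (hself hψ s) (fun ho => ?_) ?_
      · have := mcGame_owner_eq_iff.1 ho
        simp [mcPlayer0] at this
      · rintro ⟨⟨ρ, hρ⟩, t⟩ ⟨hw, ht⟩
        obtain rfl : ρ = χ := hw
        exact child t (by simp [hs t ht])
  | mu p χ ih =>
    have hfix : fix 1 p χ ∈ φ.subformulas := hψ
    obtain rfl | rfl := hb
    · refine hs.1 rfl {x | (mcGame R φ κ).Secures 0 (inside S φ (fix 1 p χ))
        (goodLeaves φ 0 (fix 1 p χ) κ') (⟨fix 1 p χ, hfix⟩, x)} fun x hx => ?_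
      exact secures_fix_of_unfold hnf hfix (ih _ (agree hfix hκ _) (iff_of_true rfl hx))
        fun _ h => h.1 rfl
    · simp only [sem, one_ne_zero, false_iff, Set.mem_sInter, Set.mem_ofPred_eq] at hs
      push Not at hs
      obtain ⟨X, hX, hsX⟩ := hs
      refine secures_fix_of_invariant hnf hfix (X := X) (fun x hx => ?_) (by simp [hsX])
      refine ih _ (agree hfix hκ _) ?_
      simp only [one_ne_zero, false_iff] at hx ⊢
      exact fun h => hx (hX h)
  | nu p χ ih =>
    have hfix : fix 0 p χ ∈ φ.subformulas := hψ
    obtain rfl | rfl := hb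
    · obtain ⟨X, hX, hsX⟩ := hs.1 rfl
      refine secures_fix_of_invariant hnf hfix (X := X) (fun x hx => ?_) (by simp [hsX])
      refine ih _ (agree hfix hκ _) ?_
      simp only [true_iff] at hx ⊢
      exact hX hx
    · by_contra hcon
      refine absurd (hs.2 ⟨{x | ¬ (mcGame R φ κ).Secures 1 (inside S φ (fix 0 p χ))
        (goodLeaves φ 1 (fix 0 p χ) κ') (⟨fix 0 p χ, hfix⟩, x)}, fun x hx => ?_, hcon⟩)
        one_ne_zero
      by_contra hx'
      exact hx (secures_fix_of_unfold hnf hfix (ih _ (agree hfix hκ _) (iff_of_false one_ne_zero hx'))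
        fun _ h => not_not.1 fun hn => one_ne_zero (h.2 hn))

end ModelChecking

/-- Correctness of the model-checking game: for a μ-calculus formula `φ` in
normal form (with all fixpoint subformulas binding their variable only
positively), a state `s` satisfies `φ` under the valuation `κ` iff Player `0`
wins the model-checking parity game `G(φ)` from the vertex `(φ, s)`. -/
theorem muCalc_sem_iff_wins_mcGame (R : S → S → Prop) (φ : MuForm P)
    (hnf : φ.NormalForm)
    (hpos : ∀ (p : P) (ψ : MuForm P),
      (MuForm.mu p ψ ∈ φ.subformulas ∨ MuForm.nu p ψ ∈ φ.subformulas) →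
      ψ.PositiveIn p)
    (κ : P → Set S) (s : S) :
    s ∈ φ.sem R κ ↔ (mcGame R φ κ).Wins0 (⟨φ, φ.self_mem_subformulas⟩, s) := by
  have hleaves : ∀ b, goodLeaves φ b φ κ = ∅ := fun b =>
    Set.eq_empty_of_forall_notMem fun v ⟨q, _, hq, hb, _⟩ => hnf.2 q hq hb
  constructor
  · intro hs
    have h := secures_of_sem (κ := κ) (b := 0) hnf hpos φ.self_mem_subformulas (fun _ _ => rfl)
      (iff_of_true rfl hs)
    rw [hleaves] at h
    exact ParityGame.wins0_of_secures h
  · intro hw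
    by_contra hs
    have h := secures_of_sem (κ := κ) (b := 1) hnf hpos φ.self_mem_subformulas (fun _ _ => rfl)
      (iff_of_false one_ne_zero hs)
    rw [hleaves] at h
    exact ParityGame.not_wins0_of_secures h hw
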